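/- arXiv:math/0111273 — 2 statements merged into one kernel-verified Lean document; each statement's English description precedes it below -/
import Mathlib

section
/- Let V be a 6-dimensional vector space over the field 𝔽₂ (= ZMod 2) equipped with a nondegenerate alternating bilinear form B, and let α ∈ V be a nonzero vector. Then the number of 2-dimensional isotropic subspaces of V containing α is exactly 15, which equals the number of 2-element subsets of a 6-element set. -/
theorem aux_card {V : Type*} [AddCommGroup V] [Module (ZMod 2) V] [Finite V]
    (P : Submodule (ZMod 2) V) (α : V) (hα : α ≠ 0) (h : α ∈ P) :
    Nat.card {v : V // v ∈ P ∧ v ≠ 0 ∧ v ≠ α} = 2 ^ Module.finrank (ZMod 2) P - 2 := by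
  have h1 : Nat.card P = 2 ^ Module.finrank (ZMod 2) P := by
    rw [Module.natCard_eq_pow_finrank (K := ZMod 2) (V := P)]
    simp
  have h2 : ((P : Set V) \ {0, α}).ncard = (P : Set V).ncard - ({0, α} : Set V).ncard := by
    apply Set.ncard_sdiff
    · intro x hx
      rcases hx with rfl | rfl
      · exact P.zero_mem
      · exact h
    · exact Set.toFinite _
  rw [Set.ncard_pair hα.symm] at h2
  have h3 : (P : Set V).ncard = Nat.card P := rfl
  rw [h3, h1] at h2
  rw [← h2, ← Nat.card_coe_set_eq]
  apply Nat.card_congr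
  apply Equiv.subtypeEquivRight
  intro x
  simp

theorem aux_span {V : Type*} [AddCommGroup V] [Module (ZMod 2) V]
    (α v : V) (hα : α ≠ 0) (hv : v ≠ 0) (hva : v ≠ α) :
    Module.finrank (ZMod 2) (Submodule.span (ZMod 2) {α, v}) = 2 := by
  have hli : LinearIndependent (ZMod 2) ![α, v] := by
    rw [LinearIndependent.pair_iff]
    intro s t hst
    have key : ∀ a : ZMod 2, a = 0 ∨ a = 1 := by decide
    rcases key s with rfl | rfl <;> rcases key t with rfl | rfl <;> simp_all
    apply hva
    have h2 : v + v = 0 := by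
      rw [← two_smul (ZMod 2) v, show (2 : ZMod 2) = 0 from rfl, zero_smul]
    rw [← h2] at hst
    exact (add_right_cancel hst).symm
  have := finrank_span_eq_card hli
  have hr : Set.range ![α, v] = {α, v} := by
    ext x
    simp [eq_comm, or_comm]
  rw [hr] at this
  simpa using this

/-- In a 6-dimensional nondegenerate alternating `𝔽₂`-space `(V, B)`
with `α ≠ 0`, the number of 2-dimensional isotropic subspaces of `V` containing `α`
is exactly `15 = (6 choose 2)`. -/
theorem card_isotropic_planes_through_alpha
    {V : Type*} [AddCommGroup V] [Module (ZMod 2) V]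
    (hdim : Module.finrank (ZMod 2) V = 6)
    (B : V →ₗ[ZMod 2] V →ₗ[ZMod 2] ZMod 2)
    (hAlt : ∀ v : V, B v v = 0)
    (hNd : ∀ v : V, (∀ w : V, B v w = 0) → v = 0)
    (α : V) (hα : α ≠ 0) :
    Nat.card {W : Submodule (ZMod 2) V //
        Module.finrank (ZMod 2) W = 2 ∧ α ∈ W ∧
        ∀ x ∈ W, ∀ y ∈ W, B x y = 0} = 15 ∧
    Nat.choose 6 2 = 15 := by
  refine ⟨?_, rfl⟩
  have : FiniteDimensional (ZMod 2) V := FiniteDimensional.of_finrank_pos (by omega)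
  have : Finite V := Module.finite_of_finite (ZMod 2)
  set T := {W : Submodule (ZMod 2) V //
        Module.finrank (ZMod 2) W = 2 ∧ α ∈ W ∧
        ∀ x ∈ W, ∀ y ∈ W, B x y = 0} with hT
  have hBα : B α ≠ 0 := fun h => hα (hNd α (fun w => by rw [h]; rfl))
  have hK : Module.finrank (ZMod 2) (LinearMap.ker (B α)) = 5 := by
    have := Module.Dual.finrank_ker_add_one_of_ne_zero (f := B α) hBα
    omega
  have hKc := aux_card (LinearMap.ker (B α)) α hα (hAlt α)
  rw [hK] at hKc
  have hW : ∀ W : T, Nat.card {v : V // v ∈ W.1 ∧ v ≠ 0 ∧ v ≠ α} = 2 := by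
    intro W
    rw [aux_card W.1 α hα W.2.2.1, W.2.1]; norm_num
  let F : (Σ W : T, {v : V // v ∈ W.1 ∧ v ≠ 0 ∧ v ≠ α}) →
      {v : V // v ∈ LinearMap.ker (B α) ∧ v ≠ 0 ∧ v ≠ α} :=
    fun p => ⟨p.2.1, p.1.2.2.2 α p.1.2.2.1 p.2.1 p.2.2.1, p.2.2.2⟩
  have hF : Function.Bijective F := by
    constructor
    · rintro ⟨⟨W, hW1, hW2, hW3⟩, v, hv, hv0, hva⟩ ⟨⟨W', hW1', hW2', hW3'⟩, v', hv', hv0', hva'⟩ h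
      have h' : v = v' := congrArg Subtype.val h
      subst h'
      have e : ∀ U : Submodule (ZMod 2) V, Module.finrank (ZMod 2) U = 2 → α ∈ U → v ∈ U →
          Submodule.span (ZMod 2) {α, v} = U := by
        intro U h1 h2 h3
        apply Submodule.eq_of_le_of_finrank_eq
        · rw [Submodule.span_le]
          rintro x (rfl | rfl)
          · exact h2
          · exact h3
        · rw [aux_span α v hα hv0 hva, h1]
      have : W = W' := (e W hW1 hW2 hv).symm.trans (e W' hW1' hW2' hv')
      subst this
      rfl
    · rintro ⟨v, hv, hv0, hva⟩
      have hv' : B α v = 0 := hv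
      have hv2 : B v α = 0 := by
        have := hAlt (α + v)
        simpa [hAlt, hv'] using this
      refine ⟨⟨⟨Submodule.span (ZMod 2) {α, v}, aux_span α v hα hv0 hva,
        Submodule.subset_span (by simp), ?_⟩, v, Submodule.subset_span (by simp), hv0, hva⟩, rfl⟩
      intro x hx y hy
      obtain ⟨a, b, rfl⟩ := Submodule.mem_span_pair.1 hx
      obtain ⟨c, d, rfl⟩ := Submodule.mem_span_pair.1 hy
      simp [hAlt, hv', hv2]
  have hc := Nat.card_congr (Equiv.ofBijective F hF)
  have : Finite T := Subtype.finite
  have := Fintype.ofFinite T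
  rw [hKc, Nat.card_sigma] at hc
  simp only [hW] at hc
  simp at hc
  rw [Nat.card_eq_fintype_card]
  omega
end

section
/- Let V be a 6-dimensional vector space over the field 𝔽₂ (= ZMod 2) equipped with a nondegenerate alternating bilinear form B, and let α ∈ V be a nonzero vector. Then the number of full isotropic flags ⟨α⟩ ⊂ L₂ ⊂ L₃, where L₂ and L₃ are isotropic subspaces of dimensions 2 and 3 respectively, is exactly 45, which equals the number of ways to partition a 6-element set into three 2-element blocks and distinguish one of the three blocks. -/
lemma flags_aux_part :
    Nat.card {Pb : Finset (Finset (Fin 6)) × Finset (Fin 6) //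
        (∀ s ∈ Pb.1, s.card = 2) ∧ (∀ x : Fin 6, ∃! s, s ∈ Pb.1 ∧ x ∈ s) ∧
        Pb.2 ∈ Pb.1} = 45 := by
  classical
  have key : ∀ (P : Finset (Finset (Fin 6))),
      ((∀ s ∈ P, s.card = 2) ∧ (∀ x : Fin 6, ∃! s, s ∈ P ∧ x ∈ s)) ↔
      P ∈ (Finset.powersetCard 3 (Finset.powersetCard 2 (Finset.univ : Finset (Fin 6)))).filter
        (fun P => ∀ x : Fin 6, (P.filter (fun s => x ∈ s)).card = 1) := by
    intro P
    have hu : ∀ x : Fin 6, (∃! s, s ∈ P ∧ x ∈ s) ↔ (P.filter (fun s => x ∈ s)).card = 1 := by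
      intro x
      rw [Finset.card_eq_one]
      constructor
      · rintro ⟨s, hs, h⟩
        refine ⟨s, ?_⟩
        ext t
        simp only [Finset.mem_filter, Finset.mem_singleton]
        exact ⟨fun ht => h t ht, fun ht => ht ▸ hs⟩
      · rintro ⟨s, h⟩
        have h' : ∀ t, (t ∈ P ∧ x ∈ t) ↔ t = s := by
          intro t
          rw [← Finset.mem_singleton, ← h, Finset.mem_filter]
        exact ⟨s, (h' s).2 rfl, fun t ht => (h' t).1 ht⟩
    simp only [hu, Finset.mem_filter, Finset.mem_powersetCard]
    constructor
    · rintro ⟨h1, h2⟩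
      refine ⟨⟨fun s hs => by simp [Finset.mem_powersetCard, h1 s hs], ?_⟩, h2⟩
      have h3 := Finset.sum_card (B := P) (n := 1) h2
      rw [Finset.sum_congr rfl h1] at h3
      simp at h3
      omega
    · rintro ⟨⟨h1, _⟩, h2⟩
      exact ⟨fun s hs => (Finset.mem_powersetCard.1 (h1 hs)).2, h2⟩
  set S := (Finset.powersetCard 3 (Finset.powersetCard 2 (Finset.univ : Finset (Fin 6)))).filter
        (fun P => ∀ x : Fin 6, (P.filter (fun s => x ∈ s)).card = 1) with hS
  have hc : S.card = 15 := by
    rw [hS]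
    decide +kernel
  have hm : ∀ P ∈ S, P.card = 3 := fun P hP =>
    (Finset.mem_powersetCard.1 (Finset.mem_filter.1 hP).1).2
  let e : {Pb : Finset (Finset (Fin 6)) × Finset (Fin 6) //
        (∀ s ∈ Pb.1, s.card = 2) ∧ (∀ x : Fin 6, ∃! s, s ∈ Pb.1 ∧ x ∈ s) ∧
        Pb.2 ∈ Pb.1} ≃ (Σ P : S, P.1) :=
    { toFun := fun p => ⟨⟨p.1.1, (key p.1.1).1 ⟨p.2.1, p.2.2.1⟩⟩, ⟨p.1.2, p.2.2.2⟩⟩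
      invFun := fun q => ⟨(q.1.1, q.2.1),
        ((key q.1.1).2 q.1.2).1, ((key q.1.1).2 q.1.2).2, q.2.2⟩
      left_inv := fun _ => rfl
      right_inv := fun _ => rfl }
  rw [Nat.card_congr e, Nat.card_sigma,
    Finset.sum_congr rfl (g := fun _ => 3) (fun P _ => by
      rw [Nat.card_eq_fintype_card, Fintype.card_coe, hm P.1 P.2])]
  simp [hc]

lemma flags_aux_sub {V : Type*} [AddCommGroup V] [Module (ZMod 2) V] [Finite V]
    (W P : Submodule (ZMod 2) V) (hWP : W ≤ P) (k n : ℕ)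
    (hW : Module.finrank (ZMod 2) W = k) (hP : Module.finrank (ZMod 2) P = n) :
    Nat.card {L : Submodule (ZMod 2) V // W ≤ L ∧ L ≤ P ∧ Module.finrank (ZMod 2) L = k + 1}
      * 2 ^ k = 2 ^ n - 2 ^ k := by
  classical
  have hcard : ∀ U : Submodule (ZMod 2) V,
      Nat.card U = 2 ^ Module.finrank (ZMod 2) U := by
    intro U
    rw [Module.natCard_eq_pow_finrank (K := ZMod 2), Nat.card_zmod]
  have hdiff : ∀ U : Submodule (ZMod 2) V, W ≤ U →
      Nat.card {x : V // x ∈ U ∧ x ∉ W} = 2 ^ Module.finrank (ZMod 2) U - 2 ^ k := by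
    intro U hU
    have h := Set.ncard_sdiff (s := (W : Set V)) (t := (U : Set V)) hU (Set.toFinite _)
    rw [← hcard, ← hW, ← hcard]
    exact h
  have hspan : ∀ (L : Submodule (ZMod 2) V) (x : V), W ≤ L →
      Module.finrank (ZMod 2) L = k + 1 → x ∈ L → x ∉ W →
      W ⊔ Submodule.span (ZMod 2) {x} = L := by
    intro L x hWL hL hx hxW
    have hle : W ⊔ Submodule.span (ZMod 2) {x} ≤ L :=
      sup_le hWL (by simpa [Submodule.span_le] using hx)
    apply Submodule.eq_of_le_of_finrank_le hle
    have hlt : W < W ⊔ Submodule.span (ZMod 2) {x} := by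
      refine lt_of_le_of_ne le_sup_left fun h => hxW ?_
      rw [h]
      exact Submodule.mem_sup_right (Submodule.mem_span_singleton_self x)
    have := Submodule.finrank_lt_finrank_of_lt hlt
    omega
  have hdim : ∀ x : V, x ∉ W →
      Module.finrank (ZMod 2) ↥(W ⊔ Submodule.span (ZMod 2) {x}) = k + 1 := by
    intro x hxW
    have hlt : W < W ⊔ Submodule.span (ZMod 2) {x} := by
      refine lt_of_le_of_ne le_sup_left fun h => hxW ?_
      rw [h]
      exact Submodule.mem_sup_right (Submodule.mem_span_singleton_self x)
    have h1 := Submodule.finrank_lt_finrank_of_lt hlt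
    have h2 := Submodule.finrank_add_le_finrank_add_finrank W (Submodule.span (ZMod 2) {x})
    have h3 : Module.finrank (ZMod 2) (Submodule.span (ZMod 2) {x}) = 1 :=
      finrank_span_singleton (fun h => hxW (h ▸ W.zero_mem))
    omega
  let e : {x : V // x ∈ P ∧ x ∉ W} ≃
      (Σ L : {L : Submodule (ZMod 2) V // W ≤ L ∧ L ≤ P ∧ Module.finrank (ZMod 2) L = k + 1},
        {x : V // x ∈ L.1 ∧ x ∉ W}) :=
    { toFun := fun x => ⟨⟨W ⊔ Submodule.span (ZMod 2) {x.1}, le_sup_left,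
          sup_le hWP (by simpa [Submodule.span_le] using x.2.1), hdim x.1 x.2.2⟩,
          ⟨x.1, Submodule.mem_sup_right (Submodule.mem_span_singleton_self x.1), x.2.2⟩⟩
      invFun := fun y => ⟨y.2.1, y.1.2.2.1 y.2.2.1, y.2.2.2⟩
      left_inv := fun x => rfl
      right_inv := by
        rintro ⟨⟨L, h1, h2, h3⟩, ⟨x, hx, hxW⟩⟩
        obtain rfl := hspan L x h1 h3 hx hxW
        rfl }
  have : Fintype {L : Submodule (ZMod 2) V // W ≤ L ∧ L ≤ P ∧ Module.finrank (ZMod 2) L = k + 1} :=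
    Fintype.ofFinite _
  have h := Nat.card_congr e
  rw [hdiff P hWP, hP, Nat.card_sigma] at h
  rw [h]
  rw [Finset.sum_congr rfl (g := fun _ => 2 ^ k)]
  · simp [Nat.card_eq_fintype_card]
  · intro L _
    rw [hdiff L.1 L.2.1, L.2.2.2, pow_succ]
    omega

/-- In a 6-dimensional nondegenerate alternating `𝔽₂`-space `(V, B)`
with `α ≠ 0`, the number of full isotropic flags `⟨α⟩ ⊂ L₂ ⊂ L₃` (with `L₂`, `L₃`
isotropic of dimensions 2 and 3) is exactly 45, which equals the number of partitions
of a 6-element set into three 2-element blocks together with a distinguished block. -/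
theorem card_full_isotropic_flags_through_alpha
    {V : Type*} [AddCommGroup V] [Module (ZMod 2) V]
    (hdim : Module.finrank (ZMod 2) V = 6)
    (B : V →ₗ[ZMod 2] V →ₗ[ZMod 2] ZMod 2)
    (hAlt : ∀ v : V, B v v = 0)
    (hNd : ∀ v : V, (∀ w : V, B v w = 0) → v = 0)
    (α : V) (hα : α ≠ 0) :
    Nat.card {L : Submodule (ZMod 2) V × Submodule (ZMod 2) V //
        α ∈ L.1 ∧ L.1 ≤ L.2 ∧
        Module.finrank (ZMod 2) L.1 = 2 ∧ Module.finrank (ZMod 2) L.2 = 3 ∧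
        (∀ x ∈ L.1, ∀ y ∈ L.1, B x y = 0) ∧
        (∀ x ∈ L.2, ∀ y ∈ L.2, B x y = 0)} = 45 ∧
    Nat.card {Pb : Finset (Finset (Fin 6)) × Finset (Fin 6) //
        (∀ s ∈ Pb.1, s.card = 2) ∧ (∀ x : Fin 6, ∃! s, s ∈ Pb.1 ∧ x ∈ s) ∧
        Pb.2 ∈ Pb.1} = 45 := by
  refine ⟨?_, flags_aux_part⟩
  classical
  have hfd : FiniteDimensional (ZMod 2) V := Module.finite_of_finrank_pos (by omega)
  have hfin : Finite V := Module.finite_of_finite (ZMod 2)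
  have halt : LinearMap.IsAlt B := hAlt
  have hswap : ∀ x y, B x y = 0 → B y x = 0 := fun x y h => halt.isRefl x y h
  have hnd : LinearMap.BilinForm.Nondegenerate B := by
    refine ⟨hNd, fun v h => hNd v fun w => hswap _ _ (h w)⟩
  have horth : ∀ W : Submodule (ZMod 2) V,
      Module.finrank (ZMod 2) (LinearMap.BilinForm.orthogonal B W)
        = 6 - Module.finrank (ZMod 2) W := by
    intro W
    rw [LinearMap.BilinForm.finrank_orthogonal hnd, hdim]
  have hmem : ∀ (W : Submodule (ZMod 2) V) (x : V),
      x ∈ LinearMap.BilinForm.orthogonal B W ↔ ∀ w ∈ W, B w x = 0 := fun W x => Iff.rfl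
  -- isotropy of codimension one extensions
  have hiso : ∀ (W L : Submodule (ZMod 2) V) (k : ℕ), W ≤ L →
      Module.finrank (ZMod 2) W = k → Module.finrank (ZMod 2) L = k + 1 →
      L ≤ LinearMap.BilinForm.orthogonal B W → ∀ x ∈ L, ∀ y ∈ L, B x y = 0 := by
    intro W L k hWL hW hL hLo
    have hlt : W < L := lt_of_le_of_ne hWL (by rintro rfl; omega)
    obtain ⟨z, hz, hzW⟩ := SetLike.exists_of_lt hlt
    have hlt2 : W < W ⊔ Submodule.span (ZMod 2) {z} := by
      refine lt_of_le_of_ne le_sup_left fun h => hzW ?_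
      rw [h]
      exact Submodule.mem_sup_right (Submodule.mem_span_singleton_self z)
    have hE : W ⊔ Submodule.span (ZMod 2) {z} = L := by
      apply Submodule.eq_of_le_of_finrank_le
        (sup_le hWL (by simpa [Submodule.span_le] using hz))
      have := Submodule.finrank_lt_finrank_of_lt hlt2
      omega
    intro x hx y hy
    have hx' := hx
    have hy' := hy
    rw [← hE, Submodule.mem_sup] at hx' hy'
    obtain ⟨w, hw, u, hu, rfl⟩ := hx'
    obtain ⟨w', hw', u', hu', rfl⟩ := hy'
    obtain ⟨a, rfl⟩ := Submodule.mem_span_singleton.1 hu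
    obtain ⟨b, rfl⟩ := Submodule.mem_span_singleton.1 hu'
    have e1 : B w (w' + b • z) = 0 := (hmem W _).1 (hLo hy) w hw
    have e2 : B z w' = 0 := hswap _ _ ((hmem W _).1 (hLo hz) w' hw')
    simp only [map_add, LinearMap.add_apply, map_smul, LinearMap.smul_apply, smul_eq_mul] at e1 ⊢
    rw [e2, hAlt]
    simpa using e1
  let A := Submodule.span (ZMod 2) {α}
  have hA : Module.finrank (ZMod 2) A = 1 := finrank_span_singleton hα
  have hAiso : A ≤ LinearMap.BilinForm.orthogonal B A := by
    intro x hx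
    rw [hmem]
    intro w hw
    obtain ⟨a, rfl⟩ := Submodule.mem_span_singleton.1 hx
    obtain ⟨b, rfl⟩ := Submodule.mem_span_singleton.1 hw
    simp [hAlt]
  let X := {L : Submodule (ZMod 2) V // A ≤ L ∧ L ≤ LinearMap.BilinForm.orthogonal B A ∧
    Module.finrank (ZMod 2) L = 1 + 1}
  let Y := fun W : Submodule (ZMod 2) V => {L : Submodule (ZMod 2) V // W ≤ L ∧
    L ≤ LinearMap.BilinForm.orthogonal B W ∧ Module.finrank (ZMod 2) L = 2 + 1}
  have hX : Nat.card X = 15 := by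
    have := flags_aux_sub A _ hAiso 1 5 hA (by rw [horth, hA])
    change Nat.card X * _ = _ at this
    omega
  have hY : ∀ W : X, Nat.card (Y W.1) = 3 := by
    intro W
    have hi := hiso A W.1 1 W.2.1 hA W.2.2.2 W.2.2.1
    have := flags_aux_sub W.1 (LinearMap.BilinForm.orthogonal B W.1)
      (fun x hx w hw => hi w hw x hx) 2 4 W.2.2.2 (by rw [horth, W.2.2.2])
    change Nat.card (Y W.1) * _ = _ at this
    omega
  let e : {L : Submodule (ZMod 2) V × Submodule (ZMod 2) V //
        α ∈ L.1 ∧ L.1 ≤ L.2 ∧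
        Module.finrank (ZMod 2) L.1 = 2 ∧ Module.finrank (ZMod 2) L.2 = 3 ∧
        (∀ x ∈ L.1, ∀ y ∈ L.1, B x y = 0) ∧
        (∀ x ∈ L.2, ∀ y ∈ L.2, B x y = 0)} ≃ (Σ W : X, Y W.1) :=
    { toFun := fun L => 
        have hAL : A ≤ L.1.1 := (Submodule.span_singleton_le_iff_mem _ _).2 L.2.1
        ⟨⟨L.1.1, hAL, fun x hx w hw => L.2.2.2.2.2.1 w (hAL hw) x hx, L.2.2.2.1⟩,
          ⟨L.1.2, L.2.2.1, fun x hx w hw => L.2.2.2.2.2.2 w (L.2.2.1 hw) x hx, L.2.2.2.2.1⟩⟩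
      invFun := fun F => ⟨(F.1.1, F.2.1),
        (Submodule.span_singleton_le_iff_mem _ _).1 F.1.2.1, F.2.2.1, F.1.2.2.2, F.2.2.2.2,
        hiso A F.1.1 1 F.1.2.1 hA F.1.2.2.2 F.1.2.2.1,
        hiso F.1.1 F.2.1 2 F.2.2.1 F.1.2.2.2 F.2.2.2.2 F.2.2.2.1⟩
      left_inv := fun L => rfl
      right_inv := fun F => rfl }
  rw [Nat.card_congr e]
  have : Fintype X := Fintype.ofFinite _
  rw [Nat.card_sigma, Finset.sum_congr rfl (fun W _ => hY W)]
  rw [Nat.card_eq_fintype_card] at hX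
  simp [hX]
end
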